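/- Let a ≥ 0, b > 0, c > 0, s_* = (b + √(b² + 24ac))/(4c), Q_∞ = s_*(e_z⊗e_z − I/3), and define ∇f(Q) = −aQ − b(Q² − (|Q|²/3)I) + c|Q|²Q for Q ∈ S₀. Then there exists q̃₀ > 0 depending only on a, b, c such that: (i) ∇f(Q)·(Q − Q_∞) ≥ 0 for every Q ∈ S₀ with |Q − Q_∞| ≥ q̃₀; and (ii) |s_*(n⊗n − I/3) − Q_∞| ≤ q̃₀ for every unit vector n ∈ S². -/

import Mathlib

open MeasureTheory Filter Metric Real Set
open scoped ENNReal NNReal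
noncomputable section

abbrev E3 : Type := EuclideanSpace ℝ (Fin 3)
abbrev Mat3 : Type := Matrix (Fin 3) (Fin 3) ℝ

def isS0 (Q : Mat3) : Prop := Q.IsSymm ∧ Q.trace = 0
def minner (A B : Mat3) : ℝ := (A * B).trace
def mnormSq (A : Mat3) : ℝ := (A * A).trace
def mnorm (A : Mat3) : ℝ := Real.sqrt (mnormSq A)
def outer (u v : E3) : Mat3 := Matrix.of fun i j => u i * v j
def ez : E3 := EuclideanSpace.single 2 1
def er (x : E3) : E3 := ‖x‖⁻¹ • x
def sstar (a b c : ℝ) : ℝ := (b + Real.sqrt (b ^ 2 + 24 * a * c)) / (4 * c)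
def Qinf (a b c : ℝ) : Mat3 := sstar a b c • (outer ez ez - (1 / 3 : ℝ) • (1 : Mat3))
def Qsurf (a b c : ℝ) (x : E3) : Mat3 :=
  sstar a b c • (outer (er x) (er x) - (1 / 3 : ℝ) • (1 : Mat3))
def Omega : Set E3 := {x | 1 < ‖x‖}
def OmegaBar : Set E3 := {x | 1 ≤ ‖x‖}

def pd (g : E3 → ℝ) (k : Fin 3) : E3 → ℝ :=
  fun x => fderivWithin ℝ g OmegaBar x (EuclideanSpace.single k 1)
def lap3 (g : E3 → ℝ) (x : E3) : ℝ := ∑ k, pd (pd g k) k x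
def matLap (Q : E3 → Mat3) (x : E3) : Mat3 := Matrix.of fun i j => lap3 (fun y => Q y i j) x
def gradSq (Q : E3 → Mat3) (x : E3) : ℝ := ∑ i, ∑ j, ∑ k, (pd (fun y => Q y i j) k x) ^ 2
def nuDeriv (Q : E3 → Mat3) (x : E3) : Mat3 :=
  Matrix.of fun i j => fderivWithin ℝ (fun y => Q y i j) OmegaBar x (-(er x))

def gradf (a b c : ℝ) (Q : Mat3) : Mat3 :=
  (-a) • Q - b • (Q * Q - (mnormSq Q / 3) • (1 : Mat3)) + (c * mnormSq Q) • Q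

def gpot (a b c : ℝ) (Q : Mat3) : ℝ :=
  -(a / 2) * (Q * Q).trace - (b / 3) * (Q * Q * Q).trace + (c / 4) * ((Q * Q).trace) ^ 2
def Cconst (a b c : ℝ) : ℝ := -sInf (gpot a b c '' {Q | isS0 Q})
def fpot (a b c : ℝ) (Q : Mat3) : ℝ := gpot a b c Q + Cconst a b c

def RegC (m : ℕ) (Q : E3 → Mat3) : Prop :=
  ∀ i j, ContDiffOn ℝ m (fun x => Q x i j) OmegaBar

def memH (a b c : ℝ) (Q : E3 → Mat3) : Prop :=
  (∀ x ∈ OmegaBar, isS0 (Q x)) ∧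
  IntegrableOn (fun x => gradSq Q x) Omega volume ∧
  IntegrableOn (fun x => mnormSq (Q x - Qinf a b c) / ‖x‖ ^ 2) Omega volume

def isEL (a b c L : ℝ) (Q : E3 → Mat3) : Prop :=
  ∀ x ∈ Omega, L • matLap Q x = gradf a b c (Q x)

def weakAnchor (a b c L W : ℝ) (Q : E3 → Mat3) : Prop :=
  ∀ x : E3, ‖x‖ = 1 → (L / W) • nuDeriv Q x = Qsurf a b c x - Q x

def coef1 (w : ℝ≥0∞) : ℝ := if w = ⊤ then 1 else w.toReal / (1 + w.toReal)
def coef3 (w : ℝ≥0∞) : ℝ := if w = ⊤ then 1 else w.toReal / (3 + w.toReal)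

def Q0 (a b c : ℝ) (w : ℝ≥0∞) (x : E3) : Mat3 :=
  (sstar a b c * coef3 w / ‖x‖ ^ 3) • (outer (er x) (er x) - (1 / 3 : ℝ) • (1 : Mat3))
  + (sstar a b c * (1 - coef1 w / ‖x‖)) • (outer ez ez - (1 / 3 : ℝ) • (1 : Mat3))

def repeatedEig (Q : Mat3) : Prop := ∃ t : ℝ, 2 ≤ Polynomial.rootMultiplicity t (Matrix.charpoly Q)

def vec3 (p q r : ℝ) : E3 := (WithLp.equiv 2 (Fin 3 → ℝ)).symm ![p, q, r]

theorem abs_mul_apply_le {A B : Mat3} {α β : ℝ} (hA : ∀ i j, |A i j| ≤ α)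
    (hB : ∀ i j, |B i j| ≤ β) (i j : Fin 3) : |(A * B) i j| ≤ 3 * α * β := by
  have hα : 0 ≤ α := (abs_nonneg _).trans (hA 0 0)
  rw [Matrix.mul_apply]
  refine (Finset.abs_sum_le_sum_abs _ _).trans ?_
  have hterm : ∀ k ∈ Finset.univ, |A i k * B k j| ≤ α * β := fun k _ => by
    rw [abs_mul]
    exact mul_le_mul (hA i k) (hB k j) (abs_nonneg _) hα
  refine (Finset.sum_le_sum hterm).trans (le_of_eq ?_)
  simp
  ring

theorem abs_trace_le {A : Mat3} {α : ℝ} (hA : ∀ i j, |A i j| ≤ α) : |A.trace| ≤ 3 * α := by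
  rw [Matrix.trace]
  refine (Finset.abs_sum_le_sum_abs _ _).trans ?_
  refine (Finset.sum_le_sum fun k _ => hA k k).trans (le_of_eq ?_)
  simp

theorem abs_trace_mul_le {A B : Mat3} {α β : ℝ} (hA : ∀ i j, |A i j| ≤ α)
    (hB : ∀ i j, |B i j| ≤ β) : |(A * B).trace| ≤ 9 * α * β :=
  (abs_trace_le (abs_mul_apply_le hA hB)).trans (le_of_eq (by ring))

theorem mnormSq_eq_sum_sq {Q : Mat3} (hQ : Q.IsSymm) : mnormSq Q = ∑ i, ∑ j, Q i j ^ 2 := by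
  simp only [mnormSq, Matrix.trace, Matrix.diag, Matrix.mul_apply]
  refine Finset.sum_congr rfl fun i _ => Finset.sum_congr rfl fun j _ => ?_
  rw [hQ.apply i j, sq]

theorem sq_mnorm {Q : Mat3} (hQ : Q.IsSymm) : mnorm Q ^ 2 = mnormSq Q := by
  refine Real.sq_sqrt ?_
  rw [mnormSq_eq_sum_sq hQ]
  positivity

theorem abs_apply_le_mnorm {Q : Mat3} (hQ : Q.IsSymm) (i j : Fin 3) : |Q i j| ≤ mnorm Q := by
  refine Real.abs_le_sqrt ?_
  rw [mnormSq_eq_sum_sq hQ]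
  refine (Finset.single_le_sum (f := fun j => Q i j ^ 2) (fun _ _ => sq_nonneg _)
    (Finset.mem_univ j)).trans ?_
  exact Finset.single_le_sum (f := fun i => ∑ j, Q i j ^ 2)
    (fun _ _ => Finset.sum_nonneg fun _ _ => sq_nonneg _) (Finset.mem_univ i)

theorem sstar_pos {a b c : ℝ} (hb : 0 < b) (hc : 0 < c) : 0 < sstar a b c := by
  unfold sstar
  positivity

theorem abs_uniaxial_apply_le {s : ℝ} (hs : 0 ≤ s) {n : E3} (hn : ‖n‖ = 1) (i j : Fin 3) :
    |(s • (outer n n - (1 / 3 : ℝ) • (1 : Mat3))) i j| ≤ 2 * s := by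
  have hcoord : ∀ k, |n k| ≤ 1 := fun k => by
    simpa [hn] using PiLp.norm_apply_le n k
  have h1 : |n i * n j| ≤ 1 := by
    rw [abs_mul]
    exact mul_le_one₀ (hcoord i) (abs_nonneg _) (hcoord j)
  have h2 : |(1 / 3 : ℝ) * (1 : Mat3) i j| ≤ 1 := by
    rw [Matrix.one_apply]
    split_ifs <;> norm_num [abs_of_pos]
  have h3 : |n i * n j - (1 / 3 : ℝ) * (1 : Mat3) i j| ≤ 2 :=
    (abs_sub _ _).trans (by linarith)
  simp only [Matrix.smul_apply, Matrix.sub_apply, outer, Matrix.of_apply, smul_eq_mul, abs_mul,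
    abs_of_nonneg hs] at h3 ⊢
  nlinarith

theorem abs_Qinf_apply_le {a b c : ℝ} (hb : 0 < b) (hc : 0 < c) (i j : Fin 3) :
    |Qinf a b c i j| ≤ 2 * sstar a b c :=
  abs_uniaxial_apply_le (sstar_pos hb hc).le (by simp [ez]) i j

theorem mnormSq_sub (A B : Mat3) :
    mnormSq (A - B) = mnormSq A - 2 * (A * B).trace + mnormSq B := by
  simp only [mnormSq, sub_mul, mul_sub, Matrix.trace_sub, Matrix.trace_mul_comm B A]
  ring

theorem trace_Qinf (a b c : ℝ) : (Qinf a b c).trace = 0 := by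
  simp [Qinf, outer, ez, Matrix.trace, Fin.sum_univ_three]
  ring

theorem minner_gradf_sub {Q P : Mat3} (a b c : ℝ) (hQ : Q.trace = 0) (hP : P.trace = 0) :
    minner (gradf a b c Q) (Q - P) =
      -a * mnormSq Q - b * (Q * Q * Q).trace + c * mnormSq Q ^ 2
        + a * (Q * P).trace + b * (Q * Q * P).trace - c * mnormSq Q * (Q * P).trace := by
  simp only [minner, gradf, add_mul, sub_mul, mul_sub, smul_mul_assoc, one_mul, Matrix.trace_add,
    Matrix.trace_sub, Matrix.trace_smul, smul_eq_mul, hQ, hP, neg_mul, smul_sub]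
  simp only [mnormSq]
  ring

/-- there is `q̃₀ = q̃₀(a,b,c) > 0` such that (i) `∇f(Q)·(Q − Q_∞) ≥ 0`
whenever `|Q − Q_∞| ≥ q̃₀`, and (ii) `|s_*(n⊗n − I/3) − Q_∞| ≤ q̃₀` for every unit
vector `n`. -/
theorem gradf_monotone_outside
    (a b c : ℝ) (ha : 0 ≤ a) (hb : 0 < b) (hc : 0 < c) :
    ∃ q0 : ℝ, 0 < q0 ∧
      (∀ Q : Mat3, isS0 Q → q0 ≤ mnorm (Q - Qinf a b c) →
        0 ≤ minner (gradf a b c Q) (Q - Qinf a b c)) ∧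
      (∀ n : E3, ‖n‖ = 1 →
        mnorm (sstar a b c • (outer n n - (1 / 3 : ℝ) • (1 : Mat3)) - Qinf a b c) ≤ q0) := by
  set s := sstar a b c with hs
  have hs0 : 0 < s := sstar_pos hb hc
  set K := a + 27 * b + 18 * a * s + 54 * b * s + 18 * c * s with hK
  have hK0 : 0 < K := by positivity
  set R := 1 + K / c with hR
  have hR1 : 1 ≤ R := by
    have : 0 < K / c := by positivity
    linarith
  have hRK : K ≤ c * R := by
    rw [hR, mul_add, mul_div_cancel₀ _ hc.ne']
    linarith
  have hP := abs_Qinf_apply_le (a := a) hb hc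
  rw [← hs] at hP
  refine ⟨R + 18 * s, by positivity, fun Q hQ hfar => ?_, fun n hn => ?_⟩
  · obtain ⟨hsymm, htr⟩ := hQ
    set N := mnorm Q with hN
    have hent := abs_apply_le_mnorm hsymm
    have hNsq : mnormSq Q = N ^ 2 := (sq_mnorm hsymm).symm
    have hN0 : 0 ≤ N := Real.sqrt_nonneg _
    have hQP := abs_le.mp (abs_trace_mul_le hent hP)
    have hRN : R ≤ N := by
      by_contra! hlt
      have hPP := (abs_le.mp (abs_trace_mul_le hP hP)).2
      have hfar' := (Real.le_sqrt' (by positivity)).mp hfar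
      rw [mnormSq_sub, hNsq] at hfar'
      rw [← mnormSq] at hPP
      nlinarith [hQP.1, mul_pos hs0 hs0, mul_lt_mul_of_pos_left hlt hs0]
    have hN1 : 1 ≤ N := hR1.trans hRN
    have hQQQ := (abs_le.mp (abs_trace_mul_le (abs_mul_apply_le hent hent) hent)).2
    have hQQP := (abs_le.mp (abs_trace_mul_le (abs_mul_apply_le hent hent) hP)).1
    rw [minner_gradf_sub a b c htr (trace_Qinf a b c), hNsq]
    have h23 : N ^ 2 ≤ N ^ 3 := pow_le_pow_right₀ hN1 (by norm_num)
    have h13 : N ≤ N ^ 3 := le_self_pow₀ hN1 (by norm_num)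
    have e1 := mul_le_mul_of_nonneg_left hQQQ hb.le
    have e2 := mul_le_mul_of_nonneg_left hQQP hb.le
    have e3 := mul_le_mul_of_nonneg_left hQP.1 ha
    have e4 := mul_le_mul_of_nonneg_left hQP.2 (by positivity : 0 ≤ c * N ^ 2)
    have e5 := mul_le_mul_of_nonneg_left h23 ha
    have e6 := mul_le_mul_of_nonneg_left h23 (by positivity : 0 ≤ b * s)
    have e7 := mul_le_mul_of_nonneg_left h13 (by positivity : 0 ≤ a * s)
    have e8 : K * N ^ 3 ≤ c * N * N ^ 3 := by
      gcongr
      exact hRK.trans (by gcongr)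
    rw [hK] at e8
    linarith
  · have hent : ∀ i j, |(s • (outer n n - (1 / 3 : ℝ) • (1 : Mat3)) - Qinf a b c) i j|
        ≤ 4 * s := fun i j => by
      rw [Matrix.sub_apply]
      exact (abs_sub _ _).trans (by linarith [abs_uniaxial_apply_le hs0.le hn i j, hP i j])
    refine Real.sqrt_le_iff.mpr ⟨by positivity, ?_⟩
    have hsq := (abs_le.mp (abs_trace_mul_le hent hent)).2
    rw [← mnormSq] at hsq
    nlinarith [mul_pos hs0 (zero_lt_one.trans_le hR1)]
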